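/- arXiv:1812.10849 — 2 statements merged into one kernel-verified Lean document; each statement's English description precedes it below -/
import Mathlib

section
/- Let G and H be finite simple graphs such that G can be obtained from H by a sequence of edge contractions, each performed at an edge whose two endpoints have no common neighbor in the graph at the time of contraction (so no triangle is collapsed and each intermediate graph is simple). If H ∈ 𝒰, then G ∈ 𝒰. -/
open SimpleGraph

namespace Sat2

abbrev Lit (V : Type) := V × Bool
abbrev TwoCNF (V : Type) := List (Lit V × Lit V)

/-- An assignment satisfies a 2-CNF if it satisfies at least one literal
of every clause. -/
def SatTwoCNF {V : Type} (τ : V → Bool) (S : TwoCNF V) : Prop :=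
  ∀ c ∈ S, τ c.1.1 = c.1.2 ∨ τ c.2.1 = c.2.2

def TwoSatisfiable {V : Type} (S : TwoCNF V) : Prop := ∃ τ, SatTwoCNF τ S

/-- The unordered pair of underlying variables of a 2-clause. -/
def clauseVars {V : Type} (c : Lit V × Lit V) : Sym2 V := s(c.1.1, c.2.1)

/-- A 2-CNF is simple if in every clause the two literals have distinct
underlying variables, and no two distinct clauses have the same unordered
pair of underlying variables. -/
def SimpleTwoCNF {V : Type} (S : TwoCNF V) : Prop :=
  (∀ c ∈ S, c.1.1 ≠ c.2.1) ∧ (S.map clauseVars).Nodup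

/-- A 2-CNF `S` is supported on a simple graph `G` (with vertex type equal to
the variable type) when clause ↦ unordered pair of variables is a bijection
from the clauses of `S` onto the edges of `G`. -/
def SupportedOn {V : Type} (S : TwoCNF V) (G : SimpleGraph V) : Prop :=
  (S.map clauseVars).Nodup ∧ {e : Sym2 V | e ∈ S.map clauseVars} = G.edgeSet

/-- `G ∈ 𝒰`: some unsatisfiable simple 2-CNF is supported on `G`. -/
def InU {V : Type} (G : SimpleGraph V) : Prop :=
  ∃ S : TwoCNF V, SimpleTwoCNF S ∧ SupportedOn S G ∧ ¬ TwoSatisfiable S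

/-- `G` is isomorphic to a subgraph of `H`. -/
def IsSubgraphOf {α β : Type} (G : SimpleGraph α) (H : SimpleGraph β) : Prop :=
  ∃ f : α → β, Function.Injective f ∧ ∀ ⦃u v⦄, G.Adj u v → H.Adj (f u) (f v)

/-- The graph obtained from `G` by subdividing the edge `(u, v)`:
the edge `(u,v)` is replaced by a path `u – w – v` through the
new vertex `w = none`. -/
def subdivideEdge {α : Type} (G : SimpleGraph α) (u v : α) :
    SimpleGraph (Option α) :=
  SimpleGraph.fromRel (fun a b =>
    match a, b with
    | some x, some y => G.Adj x y ∧ s(x, y) ≠ s(u, v)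
    | some x, none => x = u ∨ x = v
    | _, _ => False)

/-- `IsSubdivision G H` : `H` is (up to starting isomorphism) obtained from `G`
by repeatedly subdividing edges. -/
inductive IsSubdivision : {α β : Type} → SimpleGraph α → SimpleGraph β → Prop where
  | of_iso {α β : Type} {G : SimpleGraph α} {H : SimpleGraph β} :
      (G ≃g H) → IsSubdivision G H
  | step {α β : Type} {G : SimpleGraph α} {H : SimpleGraph β} (u v : β) :
      IsSubdivision G H → H.Adj u v → IsSubdivision G (subdivideEdge H u v)

/-- `G` is a topological minor of `H`: some subdivision of `G` is isomorphic
to a subgraph of `H`. -/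
def IsTopMinor {α β : Type} (G : SimpleGraph α) (H : SimpleGraph β) : Prop :=
  ∃ (γ : Type) (G' : SimpleGraph γ), IsSubdivision G G' ∧ IsSubgraphOf G' H

/-- Contraction of the edge `(u,v)`: delete `v` and merge it into `u`. -/
def contractEdge {α : Type} (G : SimpleGraph α) (u v : α) :
    SimpleGraph {w : α // w ≠ v} :=
  SimpleGraph.fromRel (fun a b =>
    G.Adj a.val b.val ∨ (a.val = u ∧ G.Adj v b.val) ∨ (b.val = u ∧ G.Adj a.val v))

/-- `ContractionSeq H G` : `G` can be obtained from `H` by a sequence of edge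
contractions, each performed at an edge whose endpoints have no common
neighbor at the time of contraction. -/
inductive ContractionSeq : {α β : Type} → SimpleGraph α → SimpleGraph β → Prop where
  | of_iso {α β : Type} {H : SimpleGraph α} {G : SimpleGraph β} :
      (H ≃g G) → ContractionSeq H G
  | step {α β : Type} {H : SimpleGraph α} {G : SimpleGraph β} (u v : α) :
      H.Adj u v → (∀ w, ¬(H.Adj u w ∧ H.Adj v w)) →
      ContractionSeq (contractEdge H u v) G → ContractionSeq H G

/-- The butterfly graph: two triangles sharing exactly one vertex. -/
def butterfly : SimpleGraph (Fin 5) :=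
  SimpleGraph.fromEdgeSet {s(0,1), s(0,2), s(1,2), s(2,3), s(2,4), s(3,4)}

/-- The bowtie graph: two vertex-disjoint triangles joined by a single edge. -/
def bowtie : SimpleGraph (Fin 6) :=
  SimpleGraph.fromEdgeSet {s(0,1), s(0,2), s(1,2), s(2,3), s(3,4), s(3,5), s(4,5)}

/-- The complete graph on four vertices. -/
def K4 : SimpleGraph (Fin 4) := ⊤

/-- The complete tripartite graph `K_{1,1,3}`, with parts {0}, {1}, {2,3,4}. -/
def K113 : SimpleGraph (Fin 5) :=
  SimpleGraph.fromEdgeSet {s(0,1), s(0,2), s(0,3), s(0,4), s(1,2), s(1,3), s(1,4)}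

/-- The complete graph on four vertices with one edge deleted. -/
def K4minusE : SimpleGraph (Fin 4) :=
  SimpleGraph.fromEdgeSet {s(0,1), s(0,2), s(0,3), s(1,2), s(1,3)}

/-- A map `π` that is a bijection from the edges of `H` outside `E` onto the edges of `G`
transports membership in `𝒰`, provided the clauses on `E` hold under every assignment pulled
back along `π` and twisted by `κ`. -/
theorem InU.of_bijOn {V W : Type} {H : SimpleGraph V} {G : SimpleGraph W} {S : TwoCNF V}
    (hS : SupportedOn S H) (hunsat : ¬ TwoSatisfiable S) (π : V → W) (κ : V → Bool)
    (E : Set (Sym2 V)) (hE : Set.BijOn (Sym2.map π) (H.edgeSet \ E) G.edgeSet)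
    (hκ : ∀ c ∈ S, clauseVars c ∈ E → ∀ τ : W → Bool,
      (τ (π c.1.1) ^^ κ c.1.1) = c.1.2 ∨ (τ (π c.2.1) ^^ κ c.2.1) = c.2.2) :
    InU G := by
  classical
  obtain ⟨hnodup, hedges⟩ := hS
  have hmem (e : Sym2 V) : e ∈ S.map clauseVars ↔ e ∈ H.edgeSet := by
    rw [← hedges]; rfl
  let lit : Lit V → Lit W := fun l => (π l.1, l.2 ^^ κ l.1)
  let T : TwoCNF W := (S.filter fun c => clauseVars c ∉ E).map fun c => (lit c.1, lit c.2)
  have hT : T.map clauseVars = ((S.map clauseVars).filter (· ∉ E)).map (Sym2.map π) := by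
    simp only [T, List.filter_map, List.map_map]
    rfl
  have hTedges : {e : Sym2 W | e ∈ T.map clauseVars} = G.edgeSet := by
    rw [← hE.image_eq, hT]
    ext e
    simp only [Set.mem_ofPred_eq, List.mem_map (f := Sym2.map π), List.mem_filter, hmem,
      Set.mem_image, Set.mem_sdiff, decide_eq_true_eq]
  have hTnodup : (T.map clauseVars).Nodup := by
    rw [hT]
    refine List.Nodup.map_on (fun x hx y hy hxy => hE.injOn ?_ ?_ hxy) (hnodup.filter _)
    · simpa only [List.mem_filter, hmem, decide_eq_true_eq, Set.mem_sdiff] using hx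
    · simpa only [List.mem_filter, hmem, decide_eq_true_eq, Set.mem_sdiff] using hy
  refine ⟨T, ⟨fun c hc => ?_, hTnodup⟩, ⟨hTnodup, hTedges⟩, ?_⟩
  · have : clauseVars c ∈ G.edgeSet := by
      rw [← hTedges]
      exact List.mem_map_of_mem hc
    exact SimpleGraph.Adj.ne this
  · rintro ⟨τ, hτ⟩
    refine hunsat ⟨fun x => τ (π x) ^^ κ x, fun c hc => ?_⟩
    by_cases hcE : clauseVars c ∈ E
    · exact hκ c hc hcE τ
    · have hcT : (lit c.1, lit c.2) ∈ T :=
        List.mem_map.2 ⟨c, List.mem_filter.2 ⟨hc, by simpa using hcE⟩, rfl⟩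
      have h := hτ _ hcT
      simp only [lit] at h
      refine h.imp (fun h => ?_) (fun h => ?_) <;> simp [h]

theorem InU.of_iso {V W : Type} {H : SimpleGraph V} {G : SimpleGraph W} (φ : H ≃g G)
    (hH : InU H) : InU G := by
  obtain ⟨S, -, hS, hunsat⟩ := hH
  refine InU.of_bijOn hS hunsat φ (fun _ => false) ∅ ⟨?_, ?_, ?_⟩ (by simp)
  · rintro ⟨a, b⟩ ⟨h, -⟩
    exact φ.map_adj_iff.2 h
  · exact (Sym2.map.injective φ.injective).injOn
  · rintro ⟨a, b⟩ h
    refine ⟨s(φ.symm a, φ.symm b), ⟨φ.symm.map_adj_iff.2 h, by simp⟩, by simp⟩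

open Classical in
/-- The quotient map of `contractEdge H u v` on vertices. -/
noncomputable def contractVertex {V : Type} {u v : V} (huv : u ≠ v) (x : V) : {w : V // w ≠ v} :=
  if h : x = v then ⟨u, huv⟩ else ⟨x, h⟩

theorem bijOn_contractVertex {V : Type} {H : SimpleGraph V} {u v : V} (huv : H.Adj u v)
    (hcommon : ∀ w, ¬(H.Adj u w ∧ H.Adj v w)) :
    Set.BijOn (Sym2.map (contractVertex huv.ne)) (H.edgeSet \ {s(u, v)})
      (contractEdge H u v).edgeSet := by
  have hself : contractVertex huv.ne v = ⟨u, huv.ne⟩ := dif_pos rfl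
  have hne (x : V) (hx : x ≠ v) : contractVertex huv.ne x = ⟨x, hx⟩ := dif_neg hx
  refine ⟨?_, ?_, ?_⟩
  · rintro ⟨a, b⟩ ⟨hab, hE⟩
    change H.Adj a b at hab
    have hE : s(a, b) ≠ s(u, v) := hE
    rw [ne_eq, Sym2.eq_iff] at hE
    have := hab.ne
    change (contractEdge H u v).Adj (contractVertex huv.ne a) (contractVertex huv.ne b)
    simp only [contractEdge, SimpleGraph.fromRel_adj]
    by_cases ha : a = v <;> by_cases hb : b = v
    · exact absurd (ha.trans hb.symm) this
    · subst ha
      rw [hself, hne b hb]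
      grind
    · subst hb
      rw [hself, hne a ha]
      grind
    · rw [hne a ha, hne b hb]
      grind
  · rintro ⟨a, b⟩ ⟨hab, hE⟩ ⟨c, d⟩ ⟨hcd, hE'⟩ h
    change H.Adj a b at hab
    change H.Adj c d at hcd
    have hE : s(a, b) ≠ s(u, v) := hE
    have hE' : s(c, d) ≠ s(u, v) := hE'
    change s(contractVertex huv.ne a, contractVertex huv.ne b) =
      s(contractVertex huv.ne c, contractVertex huv.ne d) at h
    change s(a, b) = s(c, d)
    have hval (x : V) : (x = v ∧ (contractVertex huv.ne x).val = u) ∨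
        (x ≠ v ∧ (contractVertex huv.ne x).val = x) := by
      by_cases hx : x = v
      · exact .inl ⟨hx, by rw [hx, hself]⟩
      · exact .inr ⟨hx, by rw [hne x hx]⟩
    simp only [ne_eq, Sym2.eq_iff, Subtype.ext_iff] at h hE hE' ⊢
    have hab' := hab.symm
    have hcd' := hcd.symm
    have := hval a
    have := hval b
    have := hval c
    have := hval d
    clear hval hself hne
    have := hcommon a
    have := hcommon b
    have := hcommon c
    have := hcommon d
    have := hab.ne
    have := hcd.ne
    grind
  · rintro ⟨⟨a, ha⟩, ⟨b, hb⟩⟩ h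
    change (contractEdge H u v).Adj _ _ at h
    simp only [contractEdge, SimpleGraph.fromRel_adj] at h
    have hlift (x y : V) (hxy : H.Adj x y) (hE : s(x, y) ≠ s(u, v))
        (h : s(contractVertex huv.ne x, contractVertex huv.ne y) = s(⟨a, ha⟩, ⟨b, hb⟩)) :
        s(⟨a, ha⟩, ⟨b, hb⟩) ∈
          Sym2.map (contractVertex huv.ne) '' (H.edgeSet \ {s(u, v)}) :=
      ⟨s(x, y), ⟨hxy, hE⟩, h⟩
    obtain ⟨hab, h⟩ := h
    have hab : a ≠ b := fun h => hab (Subtype.ext h)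
    have hcases : H.Adj a b ∨ (a = u ∧ H.Adj v b) ∨ (b = u ∧ H.Adj a v) := by
      have := H.adj_comm
      grind
    clear h
    rcases hcases with h | ⟨rfl, h⟩ | ⟨rfl, h⟩
    · exact hlift a b h (by grind) (by rw [hne a ha, hne b hb])
    · exact hlift v b h (by grind) (by rw [hself, hne b hb])
    · exact hlift a v h (by grind) (by rw [hself, hne a ha])

theorem InU.contractEdge {V : Type} {H : SimpleGraph V} {u v : V} (huv : H.Adj u v)
    (hcommon : ∀ w, ¬(H.Adj u w ∧ H.Adj v w)) (hH : InU H) :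
    InU (contractEdge H u v) := by
  classical
  obtain ⟨S, -, hS, hunsat⟩ := hH
  obtain ⟨c, hc, hcuv⟩ : ∃ c ∈ S, clauseVars c = s(u, v) := by
    have : s(u, v) ∈ H.edgeSet := huv
    rw [← hS.2] at this
    exact List.mem_map.1 this
  refine InU.of_bijOn hS hunsat _ (fun x => if x = v then !(c.1.2 ^^ c.2.2) else false)
    _ (bijOn_contractVertex huv hcommon) fun c' hc' hE τ => ?_
  obtain rfl : c' = c := List.inj_on_of_nodup_map hS.1 hc' hc (Eq.trans hE hcuv.symm)
  have hself : contractVertex huv.ne v = ⟨u, huv.ne⟩ := dif_pos rfl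
  have hu : contractVertex huv.ne u = ⟨u, huv.ne⟩ := dif_neg huv.ne
  have huv' := huv.ne
  obtain ⟨⟨x, s⟩, ⟨y, t⟩⟩ := c'
  rcases Sym2.eq_iff.1 hcuv with ⟨hx, hy⟩ | ⟨hx, hy⟩ <;>
  · simp only at hx hy
    subst hx hy
    simp only [hself, hu, huv', if_true, if_false]
    generalize τ _ = z
    revert z s t
    simp

/-- If `G` is obtained from `H` by a sequence of edge contractions, each at an
edge whose endpoints have no common neighbor, and `H ∈ 𝒰`, then `G ∈ 𝒰`. -/
theorem stmt_9 {α β : Type} [Fintype α] [Fintype β]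
    (H : SimpleGraph α) (G : SimpleGraph β)
    (hc : ContractionSeq H G) (hH : InU H) : InU G := by
  induction hc with
  | of_iso φ => exact hH.of_iso φ
  | step u v huv hcommon _ ih => exact ih (hH.contractEdge huv hcommon)

end Sat2
end

section
/- Every finite connected simple graph G with at least three independent cycles (that is, with |E(G)| ≥ |V(G)| + 2) has at least one of the following four graphs as a topological minor: the butterfly, the bowtie, K₄, or K_{1,1,3}. -/
open SimpleGraph

namespace Sat2

section TopologicalMinors

variable {α β γ : Type}

lemma IsSubgraphOf.isTopMinor {H : SimpleGraph α} {G : SimpleGraph β} (h : IsSubgraphOf H G) :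
    IsTopMinor H G :=
  ⟨α, H, .of_iso .refl, h⟩

lemma IsTopMinor.mono {H : SimpleGraph α} {G : SimpleGraph β} {G' : SimpleGraph γ}
    (h : IsTopMinor H G) (hG : IsSubgraphOf G G') : IsTopMinor H G' := by
  obtain ⟨δ, K, hK, f, hf, hadj⟩ := h
  obtain ⟨g, hg, hadj'⟩ := hG
  exact ⟨δ, K, hK, g ∘ f, hg.comp hf, fun _ _ huv => hadj' (hadj huv)⟩

lemma subdivideEdge_adj_some_some {G : SimpleGraph α} {u v x y : α} :
    (subdivideEdge G u v).Adj (some x) (some y) ↔ G.Adj x y ∧ s(x, y) ≠ s(u, v) := by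
  simp only [subdivideEdge, SimpleGraph.fromRel_adj]
  constructor
  · rintro ⟨-, h | h⟩
    · exact h
    · exact ⟨h.1.symm, by rw [Sym2.eq_swap]; exact h.2⟩
  · exact fun h => ⟨by simpa using h.1.ne, Or.inl h⟩

lemma subdivideEdge_adj_some_none {G : SimpleGraph α} {u v x : α} :
    (subdivideEdge G u v).Adj (some x) none ↔ x = u ∨ x = v := by
  simp [subdivideEdge, SimpleGraph.fromRel_adj]

lemma subdivideEdge_adj_none_some {G : SimpleGraph α} {u v x : α} :
    (subdivideEdge G u v).Adj none (some x) ↔ x = u ∨ x = v := by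
  rw [SimpleGraph.adj_comm, subdivideEdge_adj_some_none]

/-- Subdividing an edge of the host graph preserves topological minors. -/
lemma IsTopMinor.subdivideEdge {H : SimpleGraph α} {G : SimpleGraph β} (h : IsTopMinor H G)
    (u v : β) : IsTopMinor H (subdivideEdge G u v) := by
  obtain ⟨δ, K, hK, f, hf, hadj⟩ := h
  by_cases hex : ∃ a b, K.Adj a b ∧ s(f a, f b) = s(u, v)
  · obtain ⟨a, b, hab, he⟩ := hex
    refine ⟨Option δ, Sat2.subdivideEdge K a b, .step a b hK hab, Option.map f,
      Option.map_injective hf, ?_⟩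
    have hmem : ∀ x, x = a ∨ x = b → f x = u ∨ f x = v := by
      rw [Sym2.eq_iff] at he
      grind
    rintro (_ | x) (_ | y) hxy
    · exact absurd hxy (SimpleGraph.irrefl _)
    · exact subdivideEdge_adj_none_some.2 (hmem _ (subdivideEdge_adj_none_some.1 hxy))
    · exact subdivideEdge_adj_some_none.2 (hmem _ (subdivideEdge_adj_some_none.1 hxy))
    · obtain ⟨h₁, h₂⟩ := subdivideEdge_adj_some_some.1 hxy
      refine subdivideEdge_adj_some_some.2 ⟨hadj h₁, fun h => h₂ ?_⟩
      exact Sym2.map.injective hf (by simpa using h.trans he.symm)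
  · refine ⟨δ, K, hK, some ∘ f, (Option.some_injective _).comp hf, fun x y hxy => ?_⟩
    exact subdivideEdge_adj_some_some.2 ⟨hadj hxy, fun h => hex ⟨x, y, hxy, h⟩⟩

/-- The graph obtained from `G` by deleting the vertex `x` and joining `a` to `b`. -/
abbrev suppressVertex (G : SimpleGraph α) (x : α) (a b : ({x}ᶜ : Set α)) :
    SimpleGraph ({x}ᶜ : Set α) :=
  G.induce {x}ᶜ ⊔ SimpleGraph.edge a b

lemma IsTopMinor.of_suppressVertex {H : SimpleGraph α} {G : SimpleGraph β} {x : β}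
    {a b : ({x}ᶜ : Set β)} (ha : G.Adj x a) (hb : G.Adj x b)
    (h : IsTopMinor H (suppressVertex G x a b)) : IsTopMinor H G := by
  refine (h.subdivideEdge a b).mono
    ⟨fun o => o.elim x Subtype.val, ?_, ?_⟩
  · rintro (_ | ⟨y, hy⟩) (_ | ⟨z, hz⟩) hyz
    · rfl
    · exact absurd hyz.symm hz
    · exact absurd hyz hy
    · simpa using hyz
  · rintro (_ | y) (_ | z) hyz
    · exact absurd hyz (SimpleGraph.irrefl _)
    · rcases subdivideEdge_adj_none_some.1 hyz with rfl | rfl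
      · exact ha
      · exact hb
    · rcases subdivideEdge_adj_some_none.1 hyz with rfl | rfl
      · exact ha.symm
      · exact hb.symm
    · obtain ⟨h₁, h₂⟩ := subdivideEdge_adj_some_some.1 hyz
      rcases h₁ with h₁ | h₁
      · exact h₁
      · exact absurd ((SimpleGraph.adj_edge _ _).1 h₁).1.symm h₂

end TopologicalMinors

section Patterns

variable {α : Type} {G : SimpleGraph α}

lemma isTopMinor_butterfly {a b c d e : α} (hnd : [a, b, c, d, e].Nodup)
    (hab : G.Adj a b) (hac : G.Adj a c) (hbc : G.Adj b c) (hcd : G.Adj c d) (hce : G.Adj c e)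
    (hde : G.Adj d e) : IsTopMinor butterfly G := by
  refine IsSubgraphOf.isTopMinor ⟨![a, b, c, d, e], ?_, ?_⟩
  · rw [← List.nodup_ofFn]; simpa using hnd
  · intro u v huv
    simp only [butterfly, SimpleGraph.fromEdgeSet_adj] at huv
    fin_cases u <;> fin_cases v <;> simp_all [SimpleGraph.adj_comm]

lemma isTopMinor_bowtie_of_adj {a b c d e f : α} (hnd : [a, b, c, d, e, f].Nodup)
    (hab : G.Adj a b) (hac : G.Adj a c) (hbc : G.Adj b c) (hcd : G.Adj c d) (hde : G.Adj d e)
    (hdf : G.Adj d f) (hef : G.Adj e f) : IsTopMinor bowtie G := by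
  refine IsSubgraphOf.isTopMinor ⟨![a, b, c, d, e, f], ?_, ?_⟩
  · rw [← List.nodup_ofFn]; simpa using hnd
  · intro u v huv
    simp only [bowtie, SimpleGraph.fromEdgeSet_adj] at huv
    fin_cases u <;> fin_cases v <;> simp_all [SimpleGraph.adj_comm]

lemma isTopMinor_K113 {a b c d e : α} (hnd : [a, b, c, d, e].Nodup)
    (hab : G.Adj a b) (hac : G.Adj a c) (had : G.Adj a d) (hae : G.Adj a e)
    (hbc : G.Adj b c) (hbd : G.Adj b d) (hbe : G.Adj b e) : IsTopMinor K113 G := by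
  refine IsSubgraphOf.isTopMinor ⟨![a, b, c, d, e], ?_, ?_⟩
  · rw [← List.nodup_ofFn]; simpa using hnd
  · intro u v huv
    simp only [K113, SimpleGraph.fromEdgeSet_adj] at huv
    fin_cases u <;> fin_cases v <;> simp_all [SimpleGraph.adj_comm]

lemma isTopMinor_K4 {s : Finset α} (hs : s.card = 4)
    (hadj : ∀ x ∈ s, ∀ y ∈ s, x ≠ y → G.Adj x y) : IsTopMinor K4 G := by
  refine IsSubgraphOf.isTopMinor
    ⟨fun i => (s.equivFinOfCardEq hs).symm i, fun i j hij => ?_, fun i j hij => ?_⟩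
  · simpa using hij
  · refine hadj _ (Subtype.prop _) _ (Subtype.prop _) fun h => hij.ne ?_
    simpa using h

/-- Two disjoint triangles joined by a path contain a subdivided bowtie. -/
lemma isTopMinor_bowtie_of_path {n : ℕ} : ∀ {α : Type} {G : SimpleGraph α} {a b c d e f : α}
    (p : G.Walk c d), p.IsPath → p.length ≤ n → [a, b, c, d, e, f].Nodup →
    G.Adj a b → G.Adj a c → G.Adj b c → G.Adj d e → G.Adj d f → G.Adj e f →
    IsTopMinor bowtie G := by
  induction n with
  | zero =>
    intro α G a b c d e f p _ hlen hnd
    have := SimpleGraph.Walk.eq_of_length_eq_zero (Nat.le_zero.1 hlen)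
    simp_all
  | succ n ih =>
    intro α G a b c d e f p hp hlen hnd hab hac hbc hde hdf hef
    cases p with
    | nil => simp at hnd
    | @cons _ x _ hcx p =>
      rw [SimpleGraph.Walk.cons_isPath_iff] at hp
      rw [SimpleGraph.Walk.length_cons] at hlen
      have hcx' := hcx.ne
      by_cases hxd : x = d
      · subst hxd
        exact isTopMinor_bowtie_of_adj hnd hab hac hbc hcx hde hdf hef
      by_cases hxe : x = e
      · subst hxe
        exact isTopMinor_bowtie_of_adj (e := d) (f := f) (by grind) hab hac hbc hcx hde.symm hef hdf
      by_cases hxf : x = f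
      · subst hxf
        exact isTopMinor_bowtie_of_adj (e := d) (f := e) (by grind) hab hac hbc hcx hdf.symm
          hef.symm hde
      by_cases hxa : x = a
      · subst hxa
        exact ih (a := c) (b := b) p hp.1 (by lia) (by grind) hbc.symm hcx hab.symm hde hdf hef
      by_cases hxb : x = b
      · subst hxb
        exact ih (a := c) (b := a) p hp.1 (by lia) (by grind) hac.symm hcx hab hde hdf hef
      cases p with
      | nil => exact absurd rfl hxd
      | @cons _ y _ hxy p =>
        rw [SimpleGraph.Walk.cons_isPath_iff] at hp
        rw [SimpleGraph.Walk.length_cons] at hlen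
        rw [SimpleGraph.Walk.support_cons, List.mem_cons, not_or] at hp
        obtain ⟨⟨hp₁, hxp⟩, -, hcp⟩ := hp
        have hyc : y ≠ c := fun h => hcp (h ▸ p.start_mem_support)
        have hsupp : ∀ z ∈ p.support, z ∈ ({x}ᶜ : Set α) := fun z hz h => hxp (h ▸ hz)
        let c' : ({x}ᶜ : Set α) := ⟨c, hcx'⟩
        let y' : ({x}ᶜ : Set α) := ⟨y, hxy.ne'⟩
        have hle : G.induce {x}ᶜ ≤ suppressVertex G x c' y' := le_sup_left
        have hcy : (suppressVertex G x c' y').Adj c' y' :=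
          Or.inr ((SimpleGraph.adj_edge _ _).2 ⟨rfl, fun h => hyc (congrArg Subtype.val h).symm⟩)
        let q := (p.induce _ hsupp).mapLe hle
        have hq : q.support.map Subtype.val = p.support := by
          simp [q, SimpleGraph.Walk.support_induce]
        have hqlen : q.length = p.length := by
          have := congrArg List.length hq
          simpa using this
        refine IsTopMinor.of_suppressVertex (a := c') (b := y') hcx.symm hxy
          (ih (a := ⟨a, Ne.symm hxa⟩) (b := ⟨b, Ne.symm hxb⟩) (e := ⟨e, Ne.symm hxe⟩)
            (f := ⟨f, Ne.symm hxf⟩) (.cons hcy q) ?_ ?_ ?_ (hle hab) (hle hac) (hle hbc)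
            (hle hde) (hle hdf) (hle hef))
        · rw [SimpleGraph.Walk.cons_isPath_iff]
          constructor
          · rw [SimpleGraph.Walk.isPath_def]
            refine List.Nodup.of_map Subtype.val ?_
            rw [hq]
            exact hp₁.support_nodup
          · intro h
            refine hcp ?_
            rw [← hq]
            exact List.mem_map_of_mem h
        · rw [SimpleGraph.Walk.length_cons, hqlen]
          lia
        · refine List.Nodup.of_map Subtype.val ?_
          simpa [c'] using hnd

lemma isTopMinor_bowtie {a b c d e f : α} (hG : G.Connected) (hnd : [a, b, c, d, e, f].Nodup)
    (hab : G.Adj a b) (hac : G.Adj a c) (hbc : G.Adj b c) (hde : G.Adj d e)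
    (hdf : G.Adj d f) (hef : G.Adj e f) : IsTopMinor bowtie G := by
  obtain ⟨p, hp⟩ := hG.exists_isPath c d
  exact isTopMinor_bowtie_of_path p hp le_rfl hnd hab hac hbc hde hdf hef

end Patterns

/-- `G` has the butterfly, the bowtie, `K₄` or `K_{1,1,3}` as a topological minor. -/
def HasRankThreeMinor {α : Type} (G : SimpleGraph α) : Prop :=
  IsTopMinor butterfly G ∨ IsTopMinor bowtie G ∨ IsTopMinor K4 G ∨ IsTopMinor K113 G

section Reductions

variable {α β : Type}

lemma HasRankThreeMinor.mono {G : SimpleGraph α} {G' : SimpleGraph β}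
    (h : HasRankThreeMinor G) (hG : IsSubgraphOf G G') : HasRankThreeMinor G' :=
  h.imp (·.mono hG) (Or.imp (·.mono hG) (Or.imp (·.mono hG) (·.mono hG)))

lemma HasRankThreeMinor.of_suppressVertex {G : SimpleGraph α} {x : α} {a b : ({x}ᶜ : Set α)}
    (ha : G.Adj x a) (hb : G.Adj x b) (h : HasRankThreeMinor (suppressVertex G x a b)) :
    HasRankThreeMinor G :=
  h.imp (.of_suppressVertex ha hb) (Or.imp (.of_suppressVertex ha hb)
    (Or.imp (.of_suppressVertex ha hb) (.of_suppressVertex ha hb)))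

lemma connected_suppressVertex {G : SimpleGraph α} (hG : G.Connected) {x : α}
    {a b : ({x}ᶜ : Set α)} (hx : ∀ y, G.Adj x y → y = a ∨ y = b) :
    (suppressVertex G x a b).Connected := by
  classical
  let φ : α → ({x}ᶜ : Set α) := fun y => if h : y = x then a else ⟨y, h⟩
  have hab : (suppressVertex G x a b).Reachable a b := by
    by_cases h : a = b
    · rw [h]
    · exact SimpleGraph.Adj.reachable (Or.inr ((SimpleGraph.adj_edge _ _).2 ⟨rfl, h⟩))
  have hφ : ∀ y (h : y ≠ x), φ y = ⟨y, h⟩ := fun y h => dif_neg h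
  have hφx : φ x = a := dif_pos rfl
  have hax : ∀ y, G.Adj x y → (suppressVertex G x a b).Reachable a (φ y) := by
    intro y hy
    rw [hφ y hy.ne']
    rcases hx y hy with rfl | rfl
    · exact .refl _
    · exact hab
  have hstep : ∀ u v, G.Adj u v → (suppressVertex G x a b).Reachable (φ u) (φ v) := by
    intro u v huv
    by_cases hu : u = x
    · subst hu
      rw [hφx]
      exact hax v huv
    by_cases hv : v = x
    · subst hv
      rw [hφx]
      exact (hax u huv.symm).symm
    rw [hφ u hu, hφ v hv]
    exact SimpleGraph.Adj.reachable (Or.inl huv)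
  have hwalk : ∀ u v, G.Walk u v → (suppressVertex G x a b).Reachable (φ u) (φ v) := by
    intro u v p
    induction p with
    | nil => exact .refl _
    | cons h _ ih => exact (hstep _ _ h).trans ih
  have : Nonempty ({x}ᶜ : Set α) := ⟨a⟩
  refine ⟨fun u v => ?_⟩
  have h := hwalk u v (hG.preconnected u v).some
  rwa [hφ u u.2, hφ v v.2] at h

end Reductions

section Irreducible

variable {α : Type} [Fintype α] {G : SimpleGraph α} [DecidableRel G.Adj]

/-- A vertex of degree two has exactly two neighbours. -/
lemma exists_neighbors_of_degree_eq_two {v : α} (hv : G.degree v = 2) :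
    ∃ a b, a ≠ b ∧ ∀ x, G.Adj v x ↔ x = a ∨ x = b := by
  classical
  obtain ⟨a, b, hab, h⟩ := Finset.card_eq_two.1 hv
  exact ⟨a, b, hab, fun x => by rw [← G.mem_neighborFinset, h]; simp⟩

lemma eq_or_eq_of_degree_eq_two {v a b : α} (hv : G.degree v = 2) (ha : G.Adj v a)
    (hb : G.Adj v b) (hab : a ≠ b) {x : α} (hx : G.Adj v x) : x = a ∨ x = b := by
  obtain ⟨c, d, -, h⟩ := exists_neighbors_of_degree_eq_two hv
  rw [h] at ha hb hx
  grind

lemma card_three_le_degree_le {k : ℕ} (hsum : ∑ x, (G.degree x - 2) = k) :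
    (Finset.univ.filter fun x => 3 ≤ G.degree x).card ≤ k := by
  rw [← hsum, Finset.card_filter]
  refine Finset.sum_le_sum fun x _ => ?_
  split_ifs <;> lia

/-- A set of at most four vertices containing the closed neighbourhood of a vertex of degree at
least three is that closed neighbourhood. -/
lemma adj_of_neighbors_subset {s : Finset α} (hs : s.card ≤ 4) {c : α} (hc : c ∈ s)
    (hdeg : 3 ≤ G.degree c) (hN : ∀ w, G.Adj c w → w ∈ s) :
    s.card = 4 ∧ ∀ d ∈ s, d ≠ c → G.Adj c d := by
  classical
  have hsub : insert c (G.neighborFinset c) ⊆ s := by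
    intro w hw
    rcases Finset.mem_insert.1 hw with rfl | hw
    · exact hc
    · exact hN w (by simpa using hw)
  have hcard : (insert c (G.neighborFinset c)).card = G.degree c + 1 := by
    rw [Finset.card_insert_of_notMem (by simp), G.card_neighborFinset_eq_degree]
  have heq := Finset.eq_of_subset_of_card_le hsub (by lia)
  refine ⟨by rw [← heq] at hs ⊢; lia, fun d hd hdc => ?_⟩
  rw [← heq] at hd
  simpa [hdc] using hd

lemma isTopMinor_K4_of_neighbors {a b : α} (hab : G.Adj a b)
    (hB : (Finset.univ.filter fun x => 3 ≤ G.degree x).card ≤ 4)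
    (hN : ∀ c, 3 ≤ G.degree c → c ≠ a → c ≠ b → ∀ w, G.Adj c w → 3 ≤ G.degree w)
    (hex : ∃ c, 3 ≤ G.degree c ∧ c ≠ a ∧ c ≠ b) : IsTopMinor K4 G := by
  have key : ∀ c, 3 ≤ G.degree c → c ≠ a → c ≠ b → _ := fun c hc hca hcb =>
    adj_of_neighbors_subset hB (c := c) (by simpa using hc) hc
      (fun w hw => by simpa using hN c hc hca hcb w hw)
  obtain ⟨c, hc, hca, hcb⟩ := hex
  refine isTopMinor_K4 (key c hc hca hcb).1 fun x hx y hy hxy => ?_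
  by_cases hx' : x ≠ a ∧ x ≠ b
  · exact (key x (by simpa using hx) hx'.1 hx'.2).2 y hy hxy.symm
  by_cases hy' : y ≠ a ∧ y ≠ b
  · exact ((key y (by simpa using hy) hy'.1 hy'.2).2 x hx hxy).symm
  have hba := hab.symm
  grind

/-- The irreducible case: all degrees are at least two, the neighbours of every vertex of degree
two are adjacent, and the cycle rank is exactly three. -/
lemma hasRankThreeMinor_of_irreducible (hG : G.Connected) (hdeg : ∀ x, 2 ≤ G.degree x)
    (hadj : ∀ v a b, G.degree v = 2 → G.Adj v a → G.Adj v b → a ≠ b → G.Adj a b)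
    (hsum : ∑ x, (G.degree x - 2) = 4) : HasRankThreeMinor G := by
  classical
  have hB := card_three_le_degree_le hsum
  by_cases htwo : ∀ v, G.degree v ≠ 2
  · have hthree : ∀ v, 3 ≤ G.degree v := fun v => by have := hdeg v; have := htwo v; lia
    obtain ⟨a⟩ := hG.nonempty
    obtain ⟨b, hb⟩ := (G.degree_pos_iff_exists_adj a).1 (by have := hdeg a; lia)
    obtain ⟨c, hc, hcb⟩ := Finset.exists_mem_ne
      (s := G.neighborFinset a) (by rw [G.card_neighborFinset_eq_degree]; exact hdeg a) b
    refine Or.inr (Or.inr (Or.inl (isTopMinor_K4_of_neighbors hb hB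
      (fun _ _ _ _ w _ => hthree w) ⟨c, hthree c, ?_, hcb⟩)))
    rintro rfl
    simp at hc
  push Not at htwo
  by_contra hnot
  simp only [HasRankThreeMinor, not_or] at hnot
  obtain ⟨hbf, hbt, hk4, hk113⟩ := hnot
  have share : ∀ v a b, G.degree v = 2 → a ≠ b → (∀ x, G.Adj v x ↔ x = a ∨ x = b) →
      ∀ w, G.degree w = 2 → w ≠ v → w ≠ a → w ≠ b → ∀ x, G.Adj w x ↔ x = a ∨ x = b := by
    intro v a b hv hab hva w hw hwv hwa hwb
    obtain ⟨c, d, hcd, hwc⟩ := exists_neighbors_of_degree_eq_two hw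
    have av := (hva a).2 (.inl rfl)
    have bv := (hva b).2 (.inr rfl)
    have cw := (hwc c).2 (.inl rfl)
    have dw := (hwc d).2 (.inr rfl)
    have ab := hadj v a b hv av bv hab
    have cd := hadj w c d hw cw dw hcd
    have hav := av.ne
    have hbv := bv.ne
    have hcw := cw.ne
    have hdw := dw.ne
    have hvw : ¬ G.Adj v w := by rw [hva]; tauto
    have hcv : c ≠ v := by rintro rfl; exact hvw cw.symm
    have hdv : d ≠ v := by rintro rfl; exact hvw dw.symm
    by_cases hca : c = a
    · subst hca
      by_cases hdb : d = b
      · subst hdb; exact hwc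
      exact absurd (isTopMinor_butterfly (a := v) (b := b) (c := c) (d := w) (e := d)
        (by grind) bv av ab.symm cw.symm cd dw) hbf
    by_cases hcb : c = b
    · subst hcb
      by_cases hda : d = a
      · subst hda; intro x; rw [hwc]; tauto
      exact absurd (isTopMinor_butterfly (a := v) (b := a) (c := c) (d := w) (e := d)
        (by grind) av bv ab cw.symm cd dw) hbf
    by_cases hda : d = a
    · subst hda
      exact absurd (isTopMinor_butterfly (a := v) (b := b) (c := d) (d := w) (e := c)
        (by grind) bv av ab.symm dw.symm cd.symm cw) hbf
    by_cases hdb : d = b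
    · subst hdb
      exact absurd (isTopMinor_butterfly (a := v) (b := a) (c := d) (d := w) (e := c)
        (by grind) av bv ab dw.symm cd.symm cw) hbf
    exact absurd (isTopMinor_bowtie (a := v) (b := a) (c := b) (d := w) (e := c) (f := d) hG
      (by grind) av bv ab cw dw cd) hbt
  have pendant : ∀ v a b, G.degree v = 2 → a ≠ b → (∀ x, G.Adj v x ↔ x = a ∨ x = b) →
      3 ≤ G.degree a := by
    intro v a b hv hab hva
    by_contra ha
    have ha : G.degree a = 2 := by have := hdeg a; lia
    have av := (hva a).2 (.inl rfl)
    have bv := (hva b).2 (.inr rfl)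
    have ab := hadj v a b hv av bv hab
    have hna : ∀ x, G.Adj a x → x = v ∨ x = b := fun x hx =>
      eq_or_eq_of_degree_eq_two ha av.symm ab bv.ne hx
    have hthree : ∀ w, w ≠ v → w ≠ a → w ≠ b → 3 ≤ G.degree w := by
      intro w hwv hwa hwb
      by_contra hw
      have := hna w ((share v a b hv hab hva w (by have := hdeg w; lia) hwv hwa hwb a).2
        (.inl rfl)).symm
      tauto
    refine hk4 (isTopMinor_K4_of_neighbors bv.symm hB (fun c hc hcb hcv w hcw => ?_) ?_)
    · have hca : c ≠ a := by rintro rfl; lia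
      by_contra hw
      have hw : G.degree w = 2 := by have := hdeg w; lia
      by_cases hwv : w = v
      · subst hwv
        have := (hva c).1 hcw.symm
        tauto
      by_cases hwa : w = a
      · subst hwa
        have := hna c hcw.symm
        tauto
      by_cases hwb : w = b
      · subst hwb
        have := eq_or_eq_of_degree_eq_two hw bv.symm ab.symm av.ne hcw.symm
        tauto
      have := hthree w hwv hwa hwb
      lia
    · by_contra hex
      push Not at hex
      have h2 : ∀ c, c ≠ b → G.degree c = 2 := by
        intro c hcb
        by_contra hc
        have := hex c (by have := hdeg c; lia) hcb
        subst this
        exact hc hv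
      have hb : G.degree b - 2 = 4 := by
        rw [← hsum]
        exact (Finset.sum_eq_single (f := fun x => G.degree x - 2) b
          (fun c _ hc => by simp [h2 c hc])
          (fun h => absurd (Finset.mem_univ b) h)).symm
      have hcard : ({v, a} : Finset α).card < (G.neighborFinset b).card := by
        rw [G.card_neighborFinset_eq_degree]
        exact Finset.card_le_two.trans_lt (by lia)
      obtain ⟨w, hwb, hw⟩ := Finset.exists_mem_notMem_of_card_lt_card hcard
      rw [SimpleGraph.mem_neighborFinset] at hwb
      simp only [Finset.mem_insert, Finset.mem_singleton, not_or] at hw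
      have h3 := hthree w hw.1 hw.2 hwb.ne'
      have := h2 w hwb.ne'
      lia
  obtain ⟨v, hv⟩ := htwo
  obtain ⟨a, b, hab, hva⟩ := exists_neighbors_of_degree_eq_two hv
  have ha := pendant v a b hv hab hva
  have hb := pendant v b a hv hab.symm (fun x => by rw [hva]; tauto)
  have ab := hadj v a b hv ((hva a).2 (.inl rfl)) ((hva b).2 (.inr rfl)) hab
  have htw : ∀ w, G.degree w = 2 → ∀ x, G.Adj w x ↔ x = a ∨ x = b := by
    intro w hw
    by_cases hwv : w = v
    · rw [hwv]; exact hva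
    · exact share v a b hv hab hva w hw hwv (by rintro rfl; lia) (by rintro rfl; lia)
  by_cases hex : ∃ c, 3 ≤ G.degree c ∧ c ≠ a ∧ c ≠ b
  · refine hk4 (isTopMinor_K4_of_neighbors ab hB (fun c _ hca hcb w hcw => ?_) hex)
    by_contra hw
    have := (htw w (by have := hdeg w; lia) c).1 hcw.symm
    tauto
  push Not at hex
  have htwo : ∀ w, w ≠ a → w ≠ b → G.degree w = 2 := fun w hwa hwb => by
    have := hdeg w
    have := fun h => hwb (hex w h hwa)
    lia
  have hsum' : ∑ x, (G.degree x - 2) = (G.degree a - 2) + (G.degree b - 2) := by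
    rw [← Finset.sum_pair (f := fun x => G.degree x - 2) hab]
    refine (Finset.sum_subset (Finset.subset_univ _) fun x _ hx => ?_).symm
    simp only [Finset.mem_insert, Finset.mem_singleton, not_or] at hx
    simp [htwo x hx.1 hx.2]
  have finish : ∀ a b, G.Adj a b → 4 ≤ G.degree a →
      (∀ w, w ≠ a → w ≠ b → G.Adj w a ∧ G.Adj w b) → False := by
    intro a b ab h4 hw
    have h3 : 2 < ((G.neighborFinset a).erase b).card := by
      rw [Finset.card_erase_of_mem (by simpa using ab), G.card_neighborFinset_eq_degree]
      lia
    obtain ⟨x, hx, y, hy, z, hz, hxy, hxz, hyz⟩ := Finset.two_lt_card.1 h3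
    simp only [Finset.mem_erase, SimpleGraph.mem_neighborFinset] at hx hy hz
    have h1 := ab.ne
    have h2 := hx.2.ne
    have h3 := hy.2.ne
    have h4 := hz.2.ne
    exact hk113 (isTopMinor_K113 (a := a) (b := b) (c := x) (d := y) (e := z) (by grind) ab
      hx.2 hy.2 hz.2 (hw x h2.symm hx.1).2.symm (hw y h3.symm hy.1).2.symm
      (hw z h4.symm hz.1).2.symm)
  have hcommon : ∀ w, w ≠ a → w ≠ b → G.Adj w a ∧ G.Adj w b := fun w hwa hwb =>
    ⟨(htw w (htwo w hwa hwb) a).2 (.inl rfl), (htw w (htwo w hwa hwb) b).2 (.inr rfl)⟩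
  rcases Nat.lt_or_ge (G.degree a) 4 with h | h
  · exact finish b a ab.symm (by lia) fun w hwb hwa => (hcommon w hwa hwb).symm
  · exact finish a b ab h hcommon

end Irreducible

lemma hasRankThreeMinor_of_connected (n : ℕ) : ∀ {α : Type} [Fintype α] (G : SimpleGraph α),
    G.Connected → Fintype.card α + G.edgeSet.ncard ≤ n →
    Fintype.card α + 2 ≤ G.edgeSet.ncard → HasRankThreeMinor G := by
  classical
  induction n with
  | zero =>
    intro α _ G hG hn hE
    lia
  | succ n ih =>
    intro α _ G hG hn hE
    have hncard : ∀ {β : Type} (H : SimpleGraph β) [Fintype H.edgeSet],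
        H.edgeSet.ncard = H.edgeFinset.card := fun H _ => by
      rw [← H.coe_edgeFinset, Set.ncard_coe_finset]
    have hcompl : ∀ v : α, Fintype.card ({v}ᶜ : Set α) + 1 = Fintype.card α := by
      intro v
      have := Fintype.card_pos_iff.2 ⟨v⟩
      rw [Fintype.card_compl_set, Set.card_singleton]
      lia
    have hdel : ∀ v : α, (G.induce {v}ᶜ).edgeSet.ncard + G.degree v = G.edgeFinset.card := by
      intro v
      have h := G.card_edgeFinset_induce_compl_singleton v
      rw [G.card_edgeFinset_deleteIncidenceSet, ← hncard] at h
      have := G.degree_le_card_edgeFinset v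
      lia
    have hsub : ∀ v : α, IsSubgraphOf (G.induce {v}ᶜ) G := fun v =>
      ⟨Subtype.val, Subtype.val_injective, fun _ _ h => h⟩
    have : Nontrivial α := by
      by_contra hnt
      rw [not_nontrivial_iff_subsingleton] at hnt
      have : G = ⊥ := Subsingleton.elim _ _
      simp [this] at hE
    rw [hncard] at hn hE
    by_cases hone : ∃ v, G.degree v ≤ 1
    · obtain ⟨v, hv⟩ := hone
      have hpos := hG.preconnected.degree_pos_of_nontrivial v
      have hv : G.degree v = 1 := by lia
      have h₁ := hcompl v
      have h₂ := hdel v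
      refine (ih _ (hG.induce_compl_singleton_of_degree_eq_one hv) (by lia)
        (by lia)).mono (hsub v)
    by_cases hmany : Fintype.card α + 3 ≤ G.edgeFinset.card
    · have hcyc : ¬ G.IsAcyclic := fun h => by
        have := SimpleGraph.IsTree.card_edgeFinset (G := G) ⟨hG, h⟩
        lia
      rw [SimpleGraph.isAcyclic_iff_forall_adj_isBridge] at hcyc
      push Not at hcyc
      obtain ⟨x, y, hxy, hbr⟩ := hcyc
      have hcard : (G.deleteEdges {s(x, y)}).edgeSet.ncard + 1 = G.edgeFinset.card := by
        rw [SimpleGraph.edgeSet_deleteEdges, ← hncard]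
        exact Set.ncard_sdiff_singleton_add_one hxy (Set.toFinite _)
      exact (ih _ (hG.connected_delete_edge_of_not_isBridge hbr) (by lia) (by lia)).mono
        ⟨id, Function.injective_id, fun _ _ h => SimpleGraph.deleteEdges_le _ h⟩
    push Not at hone
    by_cases hsup : ∃ v a b, G.degree v = 2 ∧ G.Adj v a ∧ G.Adj v b ∧ a ≠ b ∧ ¬ G.Adj a b
    · obtain ⟨v, a, b, hv, hva, hvb, hab, hnab⟩ := hsup
      let a' : ({v}ᶜ : Set α) := ⟨a, hva.ne'⟩
      let b' : ({v}ᶜ : Set α) := ⟨b, hvb.ne'⟩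
      have hcard : (suppressVertex G v a' b').edgeSet.ncard
          = (G.induce {v}ᶜ).edgeSet.ncard + 1 := by
        have := SimpleGraph.card_edgeFinset_sup_edge (G.induce {v}ᶜ) (s := a') (t := b') hnab
          (fun h => hab (congrArg Subtype.val h))
        rwa [← hncard, ← hncard] at this
      have h₁ := hcompl v
      have h₂ := hdel v
      refine HasRankThreeMinor.of_suppressVertex (a := a') (b := b') hva hvb
        (ih _ (connected_suppressVertex hG fun y hy => ?_) (by lia) (by lia))
      exact eq_or_eq_of_degree_eq_two hv hva hvb hab hy
    push Not at hsup
    refine hasRankThreeMinor_of_irreducible hG hone hsup ?_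
    have h := G.sum_degrees_eq_twice_card_edges
    have hsplit : ∑ x, G.degree x = ∑ x, (G.degree x - 2) + ∑ _x : α, 2 := by
      rw [← Finset.sum_add_distrib]
      refine Finset.sum_congr rfl fun x _ => ?_
      have := hone x
      lia
    simp only [Finset.sum_const, Finset.card_univ, smul_eq_mul] at hsplit
    lia

/-- Every finite connected simple graph with at least three independent cycles
(`|E(G)| ≥ |V(G)| + 2`) has the butterfly, the bowtie, `K₄` or `K_{1,1,3}` as
a topological minor. -/
theorem stmt_15 {α : Type} [Fintype α] (G : SimpleGraph α)
    (hconn : G.Connected)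
    (hcyc : Fintype.card α + 2 ≤ G.edgeSet.ncard) :
    IsTopMinor butterfly G ∨ IsTopMinor bowtie G ∨
      IsTopMinor K4 G ∨ IsTopMinor K113 G :=
  hasRankThreeMinor_of_connected _ G hconn le_rfl hcyc

end Sat2
end
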